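/- For every k ≥ 0 and every word v over A = {a,b}, λ_{a^k b}(b·v) = μ_{a^k b}(v·b) and λ_{a^k b}(a·v) = a·μ_{a^k b}(v·b). -/

import Mathlib

namespace Chri

/-- Length of the longest palindromic suffix of `w`. -/
def lpsLen (w : List Bool) : ℕ :=
  ((List.range (w.length + 1)).filter
    (fun l => w.drop (w.length - l) == (w.drop (w.length - l)).reverse)).foldr max 0

/-- Right palindromic closure: the shortest palindrome having `w` as a prefix. -/
def palClosure (w : List Bool) : List Bool :=
  w ++ (w.take (w.length - lpsLen w)).reverse

/-- The iterated palindromization map ψ. -/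
def psi (v : List Bool) : List Bool :=
  v.foldl (fun w x => palClosure (w ++ [x])) []

/-- Apply a substitution (morphism of the free monoid) letter by letter. -/
def applyM (f : Bool → List Bool) (w : List Bool) : List Bool := (w.map f).flatten

/-- μ_x : x ↦ x, y ↦ xy (a = false, b = true). -/
def muL (x : Bool) : List Bool → List Bool :=
  applyM (fun y => if y = x then [x] else [x, y])

/-- λ_a = μ_a; λ_b : a ↦ ab, b ↦ b. -/
def lamL : Bool → List Bool → List Bool
  | false => applyM (fun y => if y = false then [false] else [false, true])
  | true  => applyM (fun y => if y = true then [true] else [false, true])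

/-- μ_{v₁⋯v_n} = μ_{v₁} ∘ ⋯ ∘ μ_{v_n}. -/
def muW : List Bool → List Bool → List Bool
  | [], w => w
  | x :: v, w => muL x (muW v w)

/-- λ_{v₁⋯v_n} = λ_{v₁} ∘ ⋯ ∘ λ_{v_n}. -/
def lamW : List Bool → List Bool → List Bool
  | [], w => w
  | x :: v, w => lamL x (lamW v w)

/-- Christoffel words: the letters and the words aψ(v)b. -/
def IsChristoffel (w : List Bool) : Prop :=
  w = [false] ∨ w = [true] ∨ ∃ v, w = false :: (psi v ++ [true])

/-- A word is constant if it is a power of a single letter. -/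
def IsConstant (v : List Bool) : Prop := ∃ x n, v = List.replicate n x

/-- ₊v : the longest proper suffix of v immediately preceded by the complement of
the first letter of v. -/
def plusV (v : List Bool) : List Bool :=
  (v.dropWhile (fun y => y == v.headD false)).tail

/-- v₊ : the longest proper prefix of v immediately followed by the complement of
the last letter of v. -/
def vPlus (v : List Bool) : List Bool := (plusV v.reverse).reverse

/-- α₀: the length of the first maximal block of `v` (the index). -/
def blockLen (v : List Bool) : ℕ :=
  (v.takeWhile (fun y => y == v.headD false)).length

/-- The list of lengths of the maximal blocks of equal letters of `v`
(the integral representation (α₀, …, α_n)). -/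
def blockLens : List Bool → List ℕ
  | [] => []
  | [_] => [1]
  | x :: y :: v =>
    if x = y then
      match blockLens (y :: v) with
      | [] => [1]
      | n :: ns => (n + 1) :: ns
    else 1 :: blockLens (y :: v)

/-- ext(v) = number of maximal blocks of v. -/
def ext (v : List Bool) : ℕ := (blockLens v).length

/-- π(w): the minimal period of `w` (with π(ε) = 1). -/
noncomputable def minPeriod (w : List Bool) : ℕ :=
  sInf {p | 0 < p ∧ ∀ i, i + p < w.length → w.getD i false = w.getD (i + p) false}

/-- φ_k : a ↦ a^{k+1} b, b ↦ a^k b. -/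
def phi (k : ℕ) : List Bool → List Bool :=
  applyM (fun y => if y = false then List.replicate (k + 1) false ++ [true]
                   else List.replicate k false ++ [true])

/-- φ̂_k : a ↦ a b^k, b ↦ a b^{k+1}. -/
def phiHat (k : ℕ) : List Bool → List Bool :=
  applyM (fun y => if y = false then false :: List.replicate k true
                   else false :: List.replicate (k + 1) true)

attribute [local instance] Classical.propDecidable

/-- The derivative ∂w of a proper Christoffel word w = aψ(v)b of index k:
∂(ab) = a, and otherwise the preimage of w under φ_k (if v starts with a)
or φ̂_k (if v starts with b). -/
noncomputable def derivC (w : List Bool) : List Bool :=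
  if w = [false, true] then [false]
  else if h : ∃ v, v ≠ [] ∧ w = false :: (psi v ++ [true]) then
    if h.choose.headD false = false then Function.invFun (phi (blockLen h.choose)) w
    else Function.invFun (phiHat (blockLen h.choose)) w
  else w

/-- The depth of a Christoffel word: the least d with ∂^d w a single letter. -/
noncomputable def depth (w : List Bool) : ℕ :=
  sInf {d | derivC^[d] w = [false] ∨ derivC^[d] w = [true]}

/-- The height h(v): the least n ≥ 1 such that v_(n) is constant, where
v_(1) = v and v_(n+1) = ₊(v_(n)). -/
noncomputable def height (v : List Bool) : ℕ :=
  sInf {n | 0 < n ∧ IsConstant (plusV^[n - 1] v)}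

/-- Helper computing δ_i from (α_{i-1}, δ_{i-1}) along the remaining exponents. -/
def ruleAux : ℕ → ℕ → List ℕ → List ℕ
  | _, _, [] => []
  | pa, pd, a :: rest =>
    let d := if 1 < a then 1 else if 1 < pa then 0 else 1 - pd
    d :: ruleAux a d rest

/-- The sequence δ₀, δ₁, …, δ_n computed by the recursive rule (δ₀ = 1). -/
def ruleSeq : List ℕ → List ℕ
  | [] => []
  | a :: rest => 1 :: ruleAux a 1 rest

/-- δ(v) = Σ_{i=0}^n δ_i(v), where additionally δ_n(v) = 1; δ(ε) = 1. -/
def delta (v : List Bool) : ℕ := ((ruleSeq (blockLens v)).dropLast).sum + 1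

/-- |u₁|: length of the longest prefix x₀⋯x_i of u with i < n and α₀ = ⋯ = α_i = 1
(and 0 if α₀ > 1 or n = 0). -/
def u1len (u : List Bool) : ℕ :=
  min ((blockLens u).takeWhile (fun n => n == 1)).length ((blockLens u).length - 1)

/-- |u₂|: the symmetric notion for suffixes. -/
def u2len (u : List Bool) : ℕ := u1len u.reverse

/-- The sequence H: H(1) = 0, H(2n) = H(n), H(4n±1) = H(n)+1. -/
def H : ℕ → ℕ
  | 0 => 0
  | 1 => 0
  | n + 2 =>
    if (n + 2) % 2 = 0 then H ((n + 2) / 2)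
    else if (n + 2) % 4 = 1 then H ((n + 2) / 4) + 1
    else H ((n + 3) / 4) + 1
decreasing_by all_goals omega

/-- ⟨w⟩: the word w read as an integer in base 2 (a = 0, b = 1). -/
def wordVal (w : List Bool) : ℕ :=
  w.foldl (fun acc x => 2 * acc + (if x then 1 else 0)) 0

/-- Membership in X^*: w is a concatenation of words of X. -/
def InStar (X : Set (List Bool)) (w : List Bool) : Prop :=
  ∃ l : List (List Bool), (∀ u ∈ l, u ∈ X) ∧ w = l.flatten

/-- w ∈ x⁺. -/
def PowPos (x : Bool) (w : List Bool) : Prop := ∃ k, 0 < k ∧ w = List.replicate k x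

theorem lamL_false (w : List Bool) : lamL false w = muL false w := by
  simp only [lamL, muL]
  congr 1
  funext y
  cases y <;> rfl

theorem muL_false_cons_false (w : List Bool) :
    muL false (false :: w) = false :: muL false w := by
  simp [muL, applyM]

/-- λ_b and μ_b are conjugate by the letter b. -/
theorem cons_true_lamL_true (v : List Bool) :
    true :: lamL true v = muL true v ++ [true] := by
  induction v with
  | nil => rfl
  | cons x v ih =>
    simp only [lamL, muL, applyM, List.map_cons, List.flatten_cons] at ih ⊢
    cases x <;> simp [← ih]

/-- λ_{a^k b}(b·v) = μ_{a^k b}(v·b) and λ_{a^k b}(a·v) = a·μ_{a^k b}(v·b). -/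
theorem lam_mu_akb (k : ℕ) (v : List Bool) :
    lamW (List.replicate k false ++ [true]) (true :: v) =
      muW (List.replicate k false ++ [true]) (v ++ [true]) ∧
    lamW (List.replicate k false ++ [true]) (false :: v) =
      false :: muW (List.replicate k false ++ [true]) (v ++ [true]) := by
  induction k with
  | zero =>
    have h := cons_true_lamL_true v
    have hmu : muL true (v ++ [true]) = muL true v ++ [true] := by simp [muL, applyM]
    have htrue : lamL true (true :: v) = true :: lamL true v := by simp [lamL, applyM]
    have hfalse : lamL true (false :: v) = false :: true :: lamL true v := by
      simp [lamL, applyM]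
    simp only [List.replicate_zero, List.nil_append, lamW, muW]
    rw [hmu, htrue, hfalse, h]
    exact ⟨rfl, rfl⟩
  | succ k ih =>
    simp only [List.replicate_succ, List.cons_append, lamW, muW]
    rw [ih.1, ih.2, lamL_false, lamL_false, muL_false_cons_false]
    exact ⟨rfl, rfl⟩

end Chri
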